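/- arXiv:1810.01116 — 2 statements merged into one kernel-verified Lean document; each statement's English description precedes it below -/
import Mathlib

section
/- (Theorem: IG quadrature) Let γ, δ > 0, set σ = √(γδ), and let n ≥ 1. Let z_1, …, z_n be the roots of the degree-n probabilists' Hermite polynomial He_n (these are real and simple), and define the Gauss–Hermite weights h_k = (1/He_n'(z_k)) · ∫_ℝ (He_n(t)/(t − z_k)) · φ(t) dt. Define the IG quadrature points and weights by x_k = (δ/γ)·φ_σ⁻¹(z_k) and w_k = 2h_k/(1 + φ_σ⁻¹(z_k)). Then for every integer r with 1 − n ≤ r ≤ n, Σ_{k=1}^n w_k · x_k^r = ∫₀^∞ x^r · f_IG(x|γ,δ) dx; in particular Σ_{k=1}^n w_k = 1. -/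
open MeasureTheory Real Set

/-- Inverse Gaussian density `f_IG(x | γ, δ)`. -/
noncomputable def fIG (γ δ x : ℝ) : ℝ :=
  δ / Real.sqrt (2 * Real.pi * x ^ 3) * Real.exp (-(γ * x - δ) ^ 2 / (2 * x))

/-- The map `φ_σ(x) = σ (√x − 1/√x)`. -/
noncomputable def phiMap (σ x : ℝ) : ℝ := σ * (Real.sqrt x - 1 / Real.sqrt x)

/-- The inverse map `φ_σ⁻¹(z) = 1 + z²/(2σ²) + (z/σ)√(1 + z²/(4σ²))`. -/
noncomputable def phiInv (σ z : ℝ) : ℝ :=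
  1 + z ^ 2 / (2 * σ ^ 2) + z / σ * Real.sqrt (1 + z ^ 2 / (4 * σ ^ 2))

/-- Standard normal density `φ(z) = exp(−z²/2)/√(2π)`. -/
noncomputable def stdNormalPdf (z : ℝ) : ℝ := Real.exp (-z ^ 2 / 2) / Real.sqrt (2 * Real.pi)

/-- Standard normal cumulative distribution function. -/
noncomputable def stdNormalCDF (z : ℝ) : ℝ := ∫ t in Set.Iic z, stdNormalPdf t

/-- Modified Bessel function of the second kind `K_p(z)` (integral representation). -/
noncomputable def besselK (p z : ℝ) : ℝ :=
  (1 / 2) * ∫ t in Set.Ioi (0 : ℝ), t ^ (p - 1) * Real.exp (-z * (t + 1 / t) / 2)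

/-- Generalized inverse Gaussian density `f_GIG(x | γ, δ, p)`. -/
noncomputable def fGIG (γ δ p x : ℝ) : ℝ :=
  (γ / δ) ^ p * x ^ (p - 1) / (2 * besselK p (γ * δ)) *
    Real.exp (-(γ ^ 2 * x + δ ^ 2 / x) / 2)

/-- Generalized hyperbolic density `f_GH(y | μ, β, γ, δ, p)` with `α = √(β² + γ²)`. -/
noncomputable def fGH (μ β γ δ p y : ℝ) : ℝ :=
  Real.sqrt (Real.sqrt (β ^ 2 + γ ^ 2)) *
      (γ / (Real.sqrt (β ^ 2 + γ ^ 2) * δ)) ^ p /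
      (Real.sqrt (2 * Real.pi) * besselK p (δ * γ)) *
    Real.exp (β * (y - μ)) *
    besselK (p - 1 / 2) (Real.sqrt (β ^ 2 + γ ^ 2) * Real.sqrt (δ ^ 2 + (y - μ) ^ 2)) /
    (δ ^ 2 + (y - μ) ^ 2) ^ ((1 - 2 * p) / 4)

section GaussHermite

open Polynomial

lemma stdNormalPdf_nonneg (t : ℝ) : 0 ≤ stdNormalPdf t := by
  unfold stdNormalPdf; positivity

lemma stdNormalPdf_neg (t : ℝ) : stdNormalPdf (-t) = stdNormalPdf t := by
  simp [stdNormalPdf]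

lemma continuous_stdNormalPdf : Continuous stdNormalPdf := by
  unfold stdNormalPdf; fun_prop

lemma hasDerivAt_stdNormalPdf (t : ℝ) : HasDerivAt stdNormalPdf (-t * stdNormalPdf t) t := by
  have h : HasDerivAt (fun y : ℝ => -y ^ 2 / 2) (-t) t := by
    convert! ((hasDerivAt_pow 2 t).neg.div_const 2) using 1
    simp; ring
  convert! h.exp.div_const (√(2 * π)) using 1
  unfold stdNormalPdf; ring

lemma integral_stdNormalPdf : ∫ t, stdNormalPdf t = 1 := by
  rw [← ProbabilityTheory.integral_gaussianPDFReal_eq_one 0 (v := 1) one_ne_zero]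
  congr 1; ext t
  simp [stdNormalPdf, ProbabilityTheory.gaussianPDFReal_def]; ring

lemma integrable_eval_mul_stdNormalPdf (p : ℝ[X]) :
    Integrable fun t => p.eval t * stdNormalPdf t := by
  induction p using Polynomial.induction_on' with
  | add p q hp hq => exact (hp.add hq).congr (.of_forall fun t => by simp [add_mul])
  | monomial m a =>
    have h := (integrable_rpow_mul_exp_neg_mul_sq (b := 1 / 2) (by norm_num) (s := m)
      (by linarith [m.cast_nonneg (α := ℝ)])).const_mul (a / √(2 * π))
    refine h.congr (.of_forall fun t => ?_)
    simp only [eval_monomial, stdNormalPdf, rpow_natCast]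
    rw [show -(1 / 2) * t ^ 2 = -t ^ 2 / 2 by ring]
    ring

lemma integral_comp_neg_mul_stdNormalPdf (f : ℝ → ℝ) :
    ∫ t, f (-t) * stdNormalPdf t = ∫ t, f t * stdNormalPdf t := by
  rw [← integral_neg_eq_self]
  simp [stdNormalPdf_neg]

/-- The normal expectation of a nonnegative function is half that of its symmetrization. -/
lemma two_mul_integral_mul_stdNormalPdf_of_add_neg {g : ℝ → ℝ} (hg : Continuous g)
    (hg0 : ∀ t, 0 ≤ g t) {P : ℝ[X]} (hgP : ∀ t, g t + g (-t) = P.eval t) :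
    2 * ∫ t, g t * stdNormalPdf t = ∫ t, P.eval t * stdNormalPdf t := by
  have hint : Integrable fun t => g t * stdNormalPdf t := by
    refine (integrable_eval_mul_stdNormalPdf P).mono'
      (hg.mul continuous_stdNormalPdf).aestronglyMeasurable (.of_forall fun t => ?_)
    rw [norm_of_nonneg (mul_nonneg (hg0 t) (stdNormalPdf_nonneg t)), ← hgP]
    gcongr
    · exact stdNormalPdf_nonneg t
    · linarith [hg0 (-t)]
  simp only [← hgP, add_mul]
  rw [integral_add hint (by simpa [stdNormalPdf_neg] using hint.comp_neg),
    integral_comp_neg_mul_stdNormalPdf g, two_mul]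

lemma integral_hermite_succ_mul (n : ℕ) (a : ℝ[X]) :
    ∫ t, (((hermite (n + 1)).map (Int.castRingHom ℝ)) * a).eval t * stdNormalPdf t =
      ∫ t, (((hermite n).map (Int.castRingHom ℝ)) * derivative a).eval t * stdNormalPdf t := by
  set H := (hermite n).map (Int.castRingHom ℝ) with hH
  have hs : (hermite (n + 1)).map (Int.castRingHom ℝ) = X * H - derivative H := by
    simp [hermite_succ, hH]
  rw [hs, ← sub_eq_zero, ← integral_sub (integrable_eval_mul_stdNormalPdf _)
    (integrable_eval_mul_stdNormalPdf _)]
  have hd (t : ℝ) : HasDerivAt (fun t => (-(H * a)).eval t * stdNormalPdf t)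
      (((X * H - derivative H) * a).eval t * stdNormalPdf t -
        (H * derivative a).eval t * stdNormalPdf t) t := by
    convert! ((-(H * a)).hasDerivAt t).mul (hasDerivAt_stdNormalPdf t) using 1
    simp; ring
  exact integral_eq_zero_of_hasDerivAt_of_integrable hd
    ((integrable_eval_mul_stdNormalPdf _).sub (integrable_eval_mul_stdNormalPdf _))
    (integrable_eval_mul_stdNormalPdf _)

lemma integral_hermite_mul_eq_zero (n : ℕ) (a : ℝ[X]) (ha : a.degree < n) :
    ∫ t, (((hermite n).map (Int.castRingHom ℝ)) * a).eval t * stdNormalPdf t = 0 := by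
  induction n generalizing a with
  | zero =>
    have : a = 0 := by simpa using ha
    simp [this]
  | succ n ih =>
    rw [integral_hermite_succ_mul]
    refine ih _ ?_
    by_cases h0 : a = 0
    · simp [h0]
    · exact (degree_derivative_lt h0).trans_le (Order.le_of_lt_succ (by exact_mod_cast ha))

lemma hermite_comp_neg_X (n : ℕ) : (hermite n).comp (-X) = (-1) ^ n * hermite n := by
  induction n with
  | zero => simp
  | succ n ih =>
    have h := congrArg derivative ih
    rw [derivative_comp] at h
    have hd : derivative ((-1) ^ n * hermite n) = (-1) ^ n * derivative (hermite n) := by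
      rw [show ((-1) ^ n : ℤ[X]) = C ((-1) ^ n) by simp, derivative_C_mul]
    rw [hd, derivative_neg, derivative_X] at h
    rw [hermite_succ, sub_comp, mul_comp, X_comp, ih]
    linear_combination h

lemma aeval_neg_hermite (n : ℕ) (t : ℝ) :
    aeval (-t) (hermite n) = (-1) ^ n * aeval t (hermite n) := by
  simpa [aeval_comp] using congrArg (aeval t) (hermite_comp_neg_X n)

/-- The Gauss–Hermite weight attached to the node `z`. -/
noncomputable def gaussHermiteWeight (n : ℕ) (z : ℝ) : ℝ :=
  1 / aeval z (derivative (hermite n)) *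
    ∫ t : ℝ, aeval t (hermite n) / (t - z) * stdNormalPdf t

variable {n : ℕ} {z : Fin n → ℝ}

lemma hermite_eq_nodal (hz : Function.Injective z)
    (hroot : ∀ k, aeval (z k) (hermite n) = (0 : ℝ)) :
    (hermite n).map (Int.castRingHom ℝ) = Lagrange.nodal Finset.univ z := by
  have hm : ((hermite n).map (Int.castRingHom ℝ)).Monic := (hermite_monic n).map _
  have hdeg : ((hermite n).map (Int.castRingHom ℝ)).degree = n := by
    rw [(hermite_monic n).degree_map, degree_hermite]
  refine eq_of_degree_le_of_eval_index_eq Finset.univ hz.injOn ?_ ?_ ?_ ?_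
  · simp [hdeg]
  · simp [hdeg, Lagrange.degree_nodal]
  · rw [hm.leadingCoeff, Lagrange.nodal_monic.leadingCoeff]
  · intro i hi
    rw [Lagrange.eval_nodal_at_node hi, ← hroot i, aeval_def, eval₂_eq_eval_map,
      algebraMap_int_eq]

lemma gaussHermiteWeight_eq_integral_basis (hz : Function.Injective z)
    (hroot : ∀ k, aeval (z k) (hermite n) = (0 : ℝ)) (k : Fin n) :
    gaussHermiteWeight n (z k) =
      ∫ t, (Lagrange.basis Finset.univ z k).eval t * stdNormalPdf t := by
  rw [gaussHermiteWeight, ← integral_const_mul]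
  refine integral_congr_ae ?_
  have hne : ∀ᵐ t : ℝ, t ≠ z k := by simp [ae_iff]
  filter_upwards [hne] with t ht
  rw [Lagrange.eval_basis_not_at_node (Finset.mem_univ k) ht,
    Lagrange.nodalWeight_eq_eval_derivative_nodal (Finset.mem_univ k), ← hermite_eq_nodal hz hroot,
    derivative_map]
  simp only [aeval_def, eval₂_eq_eval_map, algebraMap_int_eq]
  ring

/-- Exactness of Gauss–Hermite quadrature. -/
lemma sum_gaussHermiteWeight_mul_eval (hz : Function.Injective z)
    (hroot : ∀ k, aeval (z k) (hermite n) = (0 : ℝ)) (p : ℝ[X]) (hp : p.degree < (2 * n : ℕ)) :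
    ∑ k, gaussHermiteWeight n (z k) * p.eval (z k) = ∫ t, p.eval t * stdNormalPdf t := by
  set H := (hermite n).map (Int.castRingHom ℝ) with hH
  have hm : H.Monic := (hermite_monic n).map _
  have hdeg : H.degree = n := by rw [(hermite_monic n).degree_map, degree_hermite]
  have hHz (k) : H.eval (z k) = 0 := by
    rw [← hroot k, aeval_def, eval₂_eq_eval_map, algebraMap_int_eq]
  have hdiv : (p /ₘ H).degree < n := by
    by_cases h0 : p /ₘ H = 0
    · simp [h0]
    · have hle : H.degree ≤ p.degree := by
        by_contra! hlt
        exact h0 ((divByMonic_eq_zero_iff hm).2 hlt)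
      have hadd := degree_add_divByMonic hm hle
      have hp0 : p ≠ 0 := by rintro rfl; simp at h0
      rw [hdeg, degree_eq_natDegree h0, degree_eq_natDegree hp0] at hadd
      rw [degree_eq_natDegree hp0] at hp
      rw [degree_eq_natDegree h0]
      norm_cast at *
      omega
  have hmod : (p %ₘ H).degree < (Finset.univ : Finset (Fin n)).card := by
    simpa [hdeg] using degree_modByMonic_lt p hm
  have hsplit := modByMonic_add_div p H
  have heval (k) : p.eval (z k) = (p %ₘ H).eval (z k) := by
    conv_lhs => rw [← hsplit]
    simp [hHz]
  have hint : ∫ t, p.eval t * stdNormalPdf t = ∫ t, (p %ₘ H).eval t * stdNormalPdf t := by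
    conv_lhs => rw [← hsplit]
    simp only [eval_add, add_mul]
    rw [integral_add (integrable_eval_mul_stdNormalPdf _) (integrable_eval_mul_stdNormalPdf _),
      integral_hermite_mul_eq_zero n _ hdiv, add_zero]
  have hbasis (t : ℝ) : (p %ₘ H).eval t * stdNormalPdf t = ∑ k, (p %ₘ H).eval (z k) *
      ((Lagrange.basis Finset.univ z k).eval t * stdNormalPdf t) := by
    conv_lhs => rw [Lagrange.eq_interpolate hz.injOn hmod]
    simp only [Lagrange.interpolate_apply, eval_finsetSum, eval_mul, eval_C, Finset.sum_mul,
      mul_assoc]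
  simp_rw [hint, hbasis, heval]
  rw [integral_finsetSum _ fun i _ => (integrable_eval_mul_stdNormalPdf _).const_mul _]
  refine Finset.sum_congr rfl fun k _ => ?_
  rw [integral_const_mul, gaussHermiteWeight_eq_integral_basis hz hroot, mul_comm]

lemma exists_node_eq_neg (hz : Function.Injective z)
    (hroot : ∀ k, aeval (z k) (hermite n) = (0 : ℝ)) (k : Fin n) : ∃ j, z j = -z k := by
  have h : (Lagrange.nodal Finset.univ z).eval (-z k) = 0 := by
    rw [← hermite_eq_nodal hz hroot, ← algebraMap_int_eq, ← eval₂_eq_eval_map, ← aeval_def,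
      aeval_neg_hermite, hroot, mul_zero]
  rw [Lagrange.eval_nodal, Finset.prod_eq_zero_iff] at h
  obtain ⟨j, -, hj⟩ := h
  exact ⟨j, by linarith⟩

/-- Gauss–Hermite quadrature is exact on every function whose symmetrization is a polynomial of
degree less than `2 * n`. -/
lemma sum_gaussHermiteWeight_mul_of_add_neg (hz : Function.Injective z)
    (hroot : ∀ k, aeval (z k) (hermite n) = (0 : ℝ)) {g : ℝ → ℝ} (hg : Continuous g)
    (hg0 : ∀ t, 0 ≤ g t) {P : ℝ[X]} (hP : P.degree < (2 * n : ℕ))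
    (hgP : ∀ t, g t + g (-t) = P.eval t) :
    ∑ k, gaussHermiteWeight n (z k) * g (z k) = ∫ t, g t * stdNormalPdf t := by
  have hcard : (Finset.univ : Finset (Fin n)).card ≤ 2 * n := by simp; omega
  set p := Lagrange.interpolate Finset.univ z (fun k => g (z k))
  have hpg (k) : p.eval (z k) = g (z k) :=
    Lagrange.eval_interpolate_at_node _ hz.injOn (Finset.mem_univ k)
  have hpg' (k) : p.eval (-z k) = g (-z k) := by
    obtain ⟨j, hj⟩ := exists_node_eq_neg hz hroot k
    rw [← hj, hpg]
  have hpdeg : p.degree < (2 * n : ℕ) :=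
    (Lagrange.degree_interpolate_lt _ hz.injOn).trans_le (by exact_mod_cast hcard)
  have hpdeg' : (p.comp (-X)).degree < (2 * n : ℕ) := by
    by_cases h0 : p = 0
    · simpa [h0] using hpdeg
    · have := (natDegree_lt_iff_degree_lt h0).2 hpdeg
      refine degree_le_natDegree.trans_lt ?_
      rw [natDegree_comp, natDegree_neg, natDegree_X, mul_one]
      exact_mod_cast this
  have h1 := sum_gaussHermiteWeight_mul_eval hz hroot p hpdeg
  have h2 := sum_gaussHermiteWeight_mul_eval hz hroot _ hpdeg'
  have h3 := sum_gaussHermiteWeight_mul_eval hz hroot P hP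
  simp only [eval_comp, eval_neg, eval_X, hpg', hpg] at h1 h2
  rw [integral_comp_neg_mul_stdNormalPdf fun t => p.eval t] at h2
  rw [← two_mul_integral_mul_stdNormalPdf_of_add_neg hg hg0 hgP] at h3
  simp only [← hgP, mul_add, Finset.sum_add_distrib] at h3
  linarith

end GaussHermite

section ChangeOfVariables

lemma phiInv_eq_sq {σ : ℝ} (hσ : 0 < σ) (t : ℝ) :
    phiInv σ t = (t / (2 * σ) + √(1 + (t / (2 * σ)) ^ 2)) ^ 2 := by
  have h : t ^ 2 / (4 * σ ^ 2) = (t / (2 * σ)) ^ 2 := by ring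
  rw [phiInv, h, add_sq, sq_sqrt (by positivity)]
  field_simp
  ring

lemma add_sqrt_one_add_sq_pos (s : ℝ) : 0 < s + √(1 + s ^ 2) := by
  have : |s| < √(1 + s ^ 2) := by
    rw [← sqrt_sq_eq_abs]; exact sqrt_lt_sqrt (sq_nonneg s) (by linarith)
  linarith [neg_abs_le s]

lemma phiInv_pos {σ : ℝ} (hσ : 0 < σ) (t : ℝ) : 0 < phiInv σ t := by
  rw [phiInv_eq_sq hσ]
  exact pow_pos (add_sqrt_one_add_sq_pos _) 2

lemma phiInv_neg {σ : ℝ} (hσ : 0 < σ) (t : ℝ) : phiInv σ (-t) = (phiInv σ t)⁻¹ := by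
  refine eq_inv_of_mul_eq_one_left ?_
  rw [phiInv_eq_sq hσ, phiInv_eq_sq hσ, ← mul_pow, neg_div, neg_sq]
  have h := sq_sqrt (show 0 ≤ 1 + (t / (2 * σ)) ^ 2 by positivity)
  rw [show (-(t / (2 * σ)) + √(1 + (t / (2 * σ)) ^ 2)) * (t / (2 * σ) + √(1 + (t / (2 * σ)) ^ 2)) =
    √(1 + (t / (2 * σ)) ^ 2) ^ 2 - (t / (2 * σ)) ^ 2 by ring, h]
  ring

lemma phiInv_add_inv {σ : ℝ} (hσ : 0 < σ) (t : ℝ) :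
    phiInv σ t + (phiInv σ t)⁻¹ = 2 + t ^ 2 / σ ^ 2 := by
  rw [← phiInv_neg hσ]
  simp only [phiInv, neg_sq]
  ring

lemma phiMap_phiInv {σ : ℝ} (hσ : 0 < σ) (t : ℝ) : phiMap σ (phiInv σ t) = t := by
  have hpos := add_sqrt_one_add_sq_pos (t / (2 * σ))
  have h := sq_sqrt (show 0 ≤ 1 + (t / (2 * σ)) ^ 2 by positivity)
  rw [phiMap, phiInv_eq_sq hσ, sqrt_sq hpos.le]
  set c := √(1 + (t / (2 * σ)) ^ 2)
  have hinv : 1 / (t / (2 * σ) + c) = c - t / (2 * σ) := by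
    rw [div_eq_iff hpos.ne']; linear_combination -h
  rw [hinv]
  field_simp
  ring

lemma phiInv_phiMap {σ x : ℝ} (hσ : 0 < σ) (hx : 0 < x) : phiInv σ (phiMap σ x) = x := by
  have hs := sqrt_pos.2 hx
  have h1 : phiMap σ x / (2 * σ) = (√x - 1 / √x) / 2 := by
    rw [phiMap]; field_simp
  have h2 : 1 + ((√x - 1 / √x) / 2) ^ 2 = ((√x + 1 / √x) / 2) ^ 2 := by
    field_simp; ring
  rw [phiInv_eq_sq hσ, h1, h2, sqrt_sq (by positivity)]
  ring_nf
  exact sq_sqrt hx.le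

lemma hasDerivAt_phiInv {σ : ℝ} (hσ : 0 < σ) (t : ℝ) :
    HasDerivAt (phiInv σ) (phiInv σ t / (σ * √(1 + (t / (2 * σ)) ^ 2))) t := by
  have hc : 0 < 1 + (t / (2 * σ)) ^ 2 := by positivity
  have hs : HasDerivAt (fun t : ℝ => t / (2 * σ)) (1 / (2 * σ)) t :=
    (hasDerivAt_id t).div_const _
  have h := (hs.add (((hs.pow 2).const_add 1).sqrt hc.ne')).pow 2
  have heq : phiInv σ = fun t => (t / (2 * σ) + √(1 + (t / (2 * σ)) ^ 2)) ^ 2 :=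
    funext (phiInv_eq_sq hσ)
  rw [heq]
  convert! h using 1
  have := sqrt_pos.2 hc
  simp
  field_simp
  ring

/-- Under `x = (δ / γ) * phiInv σ t` the inverse Gaussian law becomes a weighted normal law. -/
lemma deriv_mul_fIG_phiInv {γ δ : ℝ} (hγ : 0 < γ) (hδ : 0 < δ) (t : ℝ) :
    δ / γ * (phiInv √(γ * δ) t / (√(γ * δ) * √(1 + (t / (2 * √(γ * δ))) ^ 2))) *
      fIG γ δ (δ / γ * phiInv √(γ * δ) t) =
      2 / (1 + phiInv √(γ * δ) t) * stdNormalPdf t := by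
  obtain ⟨a, ha, rfl⟩ : ∃ a, 0 < a ∧ a ^ 2 = γ := ⟨√γ, sqrt_pos.2 hγ, sq_sqrt hγ.le⟩
  obtain ⟨b, hb, rfl⟩ : ∃ b, 0 < b ∧ b ^ 2 = δ := ⟨√δ, sqrt_pos.2 hδ, sq_sqrt hδ.le⟩
  rw [← mul_pow, sqrt_sq (by positivity), phiInv_eq_sq (mul_pos ha hb)]
  have hu := add_sqrt_one_add_sq_pos (t / (2 * (a * b)))
  have hc : 0 < √(1 + (t / (2 * (a * b))) ^ 2) := sqrt_pos.2 (by positivity)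
  have hc2 := sq_sqrt (show 0 ≤ 1 + (t / (2 * (a * b))) ^ 2 by positivity)
  have ht : t = 2 * (a * b) * (t / (2 * (a * b))) := by field_simp
  generalize √(1 + (t / (2 * (a * b))) ^ 2) = c at *
  generalize t / (2 * (a * b)) = s at *
  subst ht
  obtain ⟨u, rfl⟩ : ∃ u, c = u - s := ⟨s + c, by ring⟩
  rw [add_sub_cancel] at *
  have hus : 2 * s * u = u ^ 2 - 1 := by linear_combination -hc2
  have hsqrt : √(2 * π * (b ^ 2 / a ^ 2 * u ^ 2) ^ 3) = √(2 * π) * (b / a * u) ^ 3 := by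
    rw [show (b ^ 2 / a ^ 2 * u ^ 2) ^ 3 = ((b / a * u) ^ 3) ^ 2 by ring,
      sqrt_mul (by positivity), sqrt_sq (by positivity)]
  have hexp : -(a ^ 2 * (b ^ 2 / a ^ 2 * u ^ 2) - b ^ 2) ^ 2 / (2 * (b ^ 2 / a ^ 2 * u ^ 2)) =
      -(2 * (a * b) * s) ^ 2 / 2 := by
    field_simp
    linear_combination (2 * s * u + (u ^ 2 - 1)) * hus
  rw [fIG, hsqrt, hexp, stdNormalPdf]
  have hden : 1 + u ^ 2 = 2 * u * (u - s) := by linear_combination hus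
  rw [hden]
  field_simp

lemma integral_zpow_mul_fIG {γ δ : ℝ} (hγ : 0 < γ) (hδ : 0 < δ) (r : ℤ) :
    ∫ x in Ioi (0 : ℝ), x ^ r * fIG γ δ x =
      (δ / γ) ^ r * ∫ t, 2 * phiInv √(γ * δ) t ^ r / (1 + phiInv √(γ * δ) t) * stdNormalPdf t := by
  have hσ : 0 < √(γ * δ) := sqrt_pos.2 (mul_pos hγ hδ)
  set σ := √(γ * δ) with hσdef
  have hγδ : 0 < δ / γ := div_pos hδ hγ
  have himage : (fun t => δ / γ * phiInv σ t) '' univ = Ioi 0 := by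
    ext x
    constructor
    · rintro ⟨t, -, rfl⟩
      exact mul_pos hγδ (phiInv_pos hσ t)
    · intro hx
      refine ⟨phiMap σ (x / (δ / γ)), mem_univ _, ?_⟩
      beta_reduce
      rw [phiInv_phiMap hσ (div_pos hx hγδ), mul_div_cancel₀ _ hγδ.ne']
  have hinj : InjOn (fun t => δ / γ * phiInv σ t) univ := fun a _ b _ hab => by
    rw [← phiMap_phiInv hσ a, ← phiMap_phiInv hσ b, mul_left_cancel₀ hγδ.ne' hab]
  rw [← himage, integral_image_eq_integral_abs_deriv_smul MeasurableSet.univ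
    (fun t _ => ((hasDerivAt_phiInv hσ t).const_mul (δ / γ)).hasDerivWithinAt) hinj,
    setIntegral_univ, ← integral_const_mul]
  refine integral_congr_ae (.of_forall fun t => ?_)
  have hY := phiInv_pos hσ t
  have hkey := deriv_mul_fIG_phiInv hγ hδ t
  rw [← hσdef] at hkey
  simp only [smul_eq_mul]
  rw [abs_of_pos (by positivity), mul_left_comm, hkey, mul_zpow]
  ring

open Polynomial in
lemma exists_polynomial_zpow_add_zpow {σ : ℝ} (hσ : 0 < σ) (m : ℕ) :
    ∃ P : ℝ[X], P.natDegree ≤ 2 * m ∧ ∀ t, P.eval t * (1 + phiInv σ t) =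
      phiInv σ t ^ (m + 1 : ℤ) + phiInv σ t ^ (-m : ℤ) := by
  induction m using Nat.twoStepInduction with
  | zero => exact ⟨1, by simp, fun t => by simp [add_comm]⟩
  | one =>
    refine ⟨C (1 / σ ^ 2) * X ^ 2 + 1, by compute_degree, fun t => ?_⟩
    have h := phiInv_add_inv hσ t
    have hY := (phiInv_pos hσ t).ne'
    have hp : (C (1 / σ ^ 2) * X ^ 2 + 1 : ℝ[X]).eval t = phiInv σ t + (phiInv σ t)⁻¹ - 1 := by
      rw [h]; simp; ring
    rw [hp]
    norm_num
    field_simp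
    ring
  | more m ih₀ ih₁ =>
    obtain ⟨P, hPd, hP⟩ := ih₀
    obtain ⟨Q, hQd, hQ⟩ := ih₁
    refine ⟨(C (1 / σ ^ 2) * X ^ 2 + 2) * Q - P, ?_, fun t => ?_⟩
    · refine (natDegree_sub_le _ _).trans (max_le (natDegree_mul_le.trans ?_) (by omega))
      have : (C (1 / σ ^ 2) * X ^ 2 + 2 : ℝ[X]).natDegree ≤ 2 := by compute_degree
      omega
    · have h := phiInv_add_inv hσ t
      have hY := (phiInv_pos hσ t).ne'
      have hp : (C (1 / σ ^ 2) * X ^ 2 + 2 : ℝ[X]).eval t = phiInv σ t + (phiInv σ t)⁻¹ := by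
        rw [h]; simp; ring
      rw [eval_sub, eval_mul, hp, sub_mul, mul_assoc, hP, hQ]
      simp only [zpow_neg]
      norm_cast
      field_simp
      ring

end ChangeOfVariables

lemma continuous_two_mul_phiInv_zpow_div {σ : ℝ} (hσ : 0 < σ) (r : ℤ) :
    Continuous fun t => 2 * phiInv σ t ^ r / (1 + phiInv σ t) := by
  have hc : Continuous (phiInv σ) :=
    continuous_iff_continuousAt.2 fun t => (hasDerivAt_phiInv hσ t).continuousAt
  refine (continuous_const.mul (hc.zpow₀ r fun t => .inl (phiInv_pos hσ t).ne')).div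
    (continuous_const.add hc) fun t => ?_
  have := phiInv_pos hσ t
  positivity

lemma two_mul_phiInv_zpow_div_nonneg {σ : ℝ} (hσ : 0 < σ) (r : ℤ) (t : ℝ) :
    0 ≤ 2 * phiInv σ t ^ r / (1 + phiInv σ t) := by
  have := phiInv_pos hσ t
  positivity

lemma two_mul_phiInv_zpow_div_add_neg {σ : ℝ} (hσ : 0 < σ) (r : ℤ) (t : ℝ) :
    2 * phiInv σ t ^ r / (1 + phiInv σ t) + 2 * phiInv σ (-t) ^ r / (1 + phiInv σ (-t)) =
      2 * (phiInv σ t ^ r + phiInv σ t ^ (1 - r)) / (1 + phiInv σ t) := by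
  have hY := phiInv_pos hσ t
  rw [phiInv_neg hσ, zpow_sub₀ hY.ne', zpow_one, inv_zpow]
  field_simp
  ring

open Polynomial in
lemma exists_polynomial_two_mul_phiInv_zpow_div {σ : ℝ} (hσ : 0 < σ) {n : ℕ} {r : ℤ}
    (hr₁ : 1 - (n : ℤ) ≤ r) (hr₂ : r ≤ n) : ∃ P : ℝ[X], P.degree < (2 * n : ℕ) ∧
      ∀ t, 2 * phiInv σ t ^ r / (1 + phiInv σ t) +
        2 * phiInv σ (-t) ^ r / (1 + phiInv σ (-t)) = P.eval t := by
  obtain ⟨m, hm⟩ : ∃ m : ℕ, r = m + 1 ∨ r = -m := by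
    rcases le_or_gt r 0 with h | h
    · exact ⟨(-r).toNat, .inr (by omega)⟩
    · exact ⟨(r - 1).toNat, .inl (by omega)⟩
  obtain ⟨P, hPd, hP⟩ := exists_polynomial_zpow_add_zpow hσ m
  refine ⟨C 2 * P, ?_, fun t => ?_⟩
  · refine degree_le_natDegree.trans_lt ?_
    have := (natDegree_C_mul_le 2 P).trans hPd
    have hlt : (C 2 * P).natDegree < 2 * n := by omega
    exact_mod_cast hlt
  · have hY := phiInv_pos hσ t
    rw [two_mul_phiInv_zpow_div_add_neg hσ, div_eq_iff (by positivity), eval_mul, eval_C,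
      mul_assoc, hP]
    rcases hm with rfl | rfl
    · rw [show 1 - ((m : ℤ) + 1) = -m by ring]
    · rw [show 1 - -(m : ℤ) = m + 1 by ring, add_comm (phiInv σ t ^ (-m : ℤ))]

lemma integral_two_div_one_add_phiInv {σ : ℝ} (hσ : 0 < σ) :
    ∫ t, 2 * phiInv σ t ^ (0 : ℤ) / (1 + phiInv σ t) * stdNormalPdf t = 1 := by
  have h := two_mul_integral_mul_stdNormalPdf_of_add_neg
    (continuous_two_mul_phiInv_zpow_div hσ 0) (two_mul_phiInv_zpow_div_nonneg hσ 0)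
    (P := Polynomial.C 2) fun t => by
      have hY := phiInv_pos hσ t
      rw [two_mul_phiInv_zpow_div_add_neg hσ, Polynomial.eval_C, div_eq_iff (by positivity)]
      simp
  simp only [Polynomial.eval_C] at h
  rw [integral_const_mul, integral_stdNormalPdf] at h
  linarith

/-- IG quadrature: the transformed Gauss–Hermite quadrature
`x_k = (δ/γ) φ_σ⁻¹(z_k)`, `w_k = 2 h_k/(1 + φ_σ⁻¹(z_k))` exactly integrates
`x^r` against `f_IG(·|γ,δ)` for all integers `1 − n ≤ r ≤ n`; in particular
the weights sum to one. -/
theorem ig_quadrature (γ δ : ℝ) (hγ : 0 < γ) (hδ : 0 < δ) (n : ℕ) (hn : 1 ≤ n)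
    (z : Fin n → ℝ) (hz : Function.Injective z)
    (hroot : ∀ k, Polynomial.aeval (z k) (Polynomial.hermite n) = (0 : ℝ)) :
    let σ := Real.sqrt (γ * δ)
    let h : Fin n → ℝ := fun k =>
      1 / Polynomial.aeval (z k) (Polynomial.derivative (Polynomial.hermite n)) *
        ∫ t : ℝ, Polynomial.aeval t (Polynomial.hermite n) / (t - z k) * stdNormalPdf t
    let x : Fin n → ℝ := fun k => δ / γ * phiInv σ (z k)
    let w : Fin n → ℝ := fun k => 2 * h k / (1 + phiInv σ (z k))
    (∀ r : ℤ, 1 - (n : ℤ) ≤ r → r ≤ (n : ℤ) →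
      ∑ k, w k * x k ^ r = ∫ t in Set.Ioi (0 : ℝ), t ^ r * fIG γ δ t) ∧
    ∑ k, w k = 1 := by
  intro σ h x w
  have hσ : 0 < σ := sqrt_pos.2 (mul_pos hγ hδ)
  have hquad (r : ℤ) (hr₁ : 1 - (n : ℤ) ≤ r) (hr₂ : r ≤ n) :
      ∑ k, w k * x k ^ r =
        (δ / γ) ^ r * ∫ t, 2 * phiInv σ t ^ r / (1 + phiInv σ t) * stdNormalPdf t := by
    obtain ⟨P, hPd, hP⟩ := exists_polynomial_two_mul_phiInv_zpow_div hσ hr₁ hr₂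
    rw [← sum_gaussHermiteWeight_mul_of_add_neg hz hroot
      (continuous_two_mul_phiInv_zpow_div hσ r) (two_mul_phiInv_zpow_div_nonneg hσ r) hPd hP,
      Finset.mul_sum]
    refine Finset.sum_congr rfl fun k _ => ?_
    simp only [w, x, h, gaussHermiteWeight, mul_zpow]
    ring
  refine ⟨fun r hr₁ hr₂ => by rw [hquad r hr₁ hr₂, integral_zpow_mul_fIG hγ hδ], ?_⟩
  have hsum := hquad 0 (by omega) (by omega)
  rw [integral_two_div_one_add_phiInv hσ] at hsum
  simpa using hsum
end

section
/- (European call price under the GH distribution as a Black–Scholes mixture) For all μ ∈ ℝ, β ∈ ℝ, γ, δ > 0, p ∈ ℝ with γ² > 2β + 1, and every strike K > 0, ∫_ℝ max(e^y − K, 0) · f_GH(y|μ,β,γ,δ,p) dy = ∫₀^∞ [ F(x)·N(d(x) + √x) − K·N(d(x)) ] · f_GIG(x|γ,δ,p) dx, where F(x) = exp(μ + (β + 1/2)·x), d(x) = ln(F(x)/K)/√x − √x/2, and N denotes the standard normal cumulative distribution function. -/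
open MeasureTheory Real Set

/-- Iterated integrals of a nonnegative function with integrable sections may be swapped, without
assuming integrability over the product. -/
theorem integral_integral_swap_of_nonneg {X Y : Type*} [MeasurableSpace X] [MeasurableSpace Y]
    {μ : Measure X} {ν : Measure Y} [SFinite μ] [SFinite ν] {f : X → Y → ℝ}
    (hf : StronglyMeasurable (Function.uncurry f))
    (hpos : ∀ᵐ y ∂ν, ∀ x, 0 ≤ f x y)
    (hX : ∀ x, Integrable (f x) ν) (hY : ∀ᵐ y ∂ν, Integrable (fun x => f x y) μ) :
    ∫ x, ∫ y, f x y ∂ν ∂μ = ∫ y, ∫ x, f x y ∂μ ∂ν := by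
  have hpos' : ∀ x, ∀ᵐ y ∂ν, 0 ≤ f x y := fun x => hpos.mono fun y hy => hy x
  rw [integral_eq_lintegral_of_nonneg_ae
      (Filter.Eventually.of_forall fun x => integral_nonneg_of_ae (hpos' x))
      hf.integral_prod_right.aestronglyMeasurable,
    integral_eq_lintegral_of_nonneg_ae
      (hpos.mono fun y hy => integral_nonneg hy)
      hf.integral_prod_left.aestronglyMeasurable]
  congr 1
  calc ∫⁻ x, ENNReal.ofReal (∫ y, f x y ∂ν) ∂μ
      = ∫⁻ x, ∫⁻ y, ENNReal.ofReal (f x y) ∂ν ∂μ :=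
        lintegral_congr fun x => ofReal_integral_eq_lintegral_ofReal (hX x) (hpos' x)
    _ = ∫⁻ y, ∫⁻ x, ENNReal.ofReal (f x y) ∂μ ∂ν :=
        lintegral_lintegral_swap hf.measurable.ennreal_ofReal.aemeasurable
    _ = ∫⁻ y, ENNReal.ofReal (∫ x, f x y ∂μ) ∂ν := by
        refine lintegral_congr_ae ?_
        filter_upwards [hpos, hY] with y hy hi
        exact (ofReal_integral_eq_lintegral_ofReal hi (Filter.Eventually.of_forall hy)).symm

/-- The kernel of the generalized inverse Gaussian density is integrable. -/
theorem integrableOn_rpow_mul_exp_neg_add_div {a b : ℝ} (ha : 0 < a) (hb : 0 < b) (s : ℝ) :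
    IntegrableOn (fun x : ℝ => x ^ (s - 1) * exp (-(a * x + b / x) / 2)) (Ioi 0) := by
  obtain ⟨k, hk⟩ := exists_nat_gt (-s)
  have hdom : IntegrableOn
      (fun x : ℝ => x ^ (s - 1 + k) * exp (-(a / 2) * x) * ((k.factorial : ℝ) * (2 / b) ^ k))
      (Ioi 0) := by
    have h := integrableOn_rpow_mul_exp_neg_mul_rpow (p := 1) (s := s - 1 + k) (b := a / 2)
      (by linarith) (by norm_num) (by positivity)
    simp only [rpow_one] at h
    exact h.mul_const _
  refine hdom.mono' (Measurable.aestronglyMeasurable (by fun_prop)) ?_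
  filter_upwards [ae_restrict_mem measurableSet_Ioi] with x hx
  have hx : 0 < x := hx
  rw [norm_of_nonneg (by positivity), rpow_add hx, rpow_natCast,
    show -(a * x + b / x) / 2 = -(a / 2) * x + -(b / (2 * x)) by field_simp; ring, exp_add]
  have h := pow_div_factorial_le_exp (b / (2 * x)) (by positivity) k
  have h1 : exp (-(b / (2 * x))) ≤ x ^ k * ((k.factorial : ℝ) * (2 / b) ^ k) := by
    rw [exp_neg]
    refine (inv_anti₀ (by positivity) h).trans_eq ?_
    simp only [div_pow, mul_pow]
    field_simp
  calc x ^ (s - 1) * (exp (-(a / 2) * x) * exp (-(b / (2 * x))))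
      ≤ x ^ (s - 1) * (exp (-(a / 2) * x) * (x ^ k * ((k.factorial : ℝ) * (2 / b) ^ k))) := by
        gcongr
    _ = _ := by ring

/-- The normalizing integral of the generalized inverse Gaussian density. -/
theorem integral_rpow_mul_exp_neg_add_div {a q : ℝ} (ha : 0 < a) (hq : 0 < q) (s : ℝ) :
    ∫ x in Ioi (0 : ℝ), x ^ (s - 1) * exp (-(a ^ 2 * x + q ^ 2 / x) / 2) =
      2 * (q / a) ^ s * besselK s (a * q) := by
  have hc : 0 < q / a := by positivity
  have h := integral_comp_mul_left_Ioi
    (fun x : ℝ => x ^ (s - 1) * exp (-(a ^ 2 * x + q ^ 2 / x) / 2)) 0 hc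
  rw [mul_zero, smul_eq_mul, eq_inv_mul_iff_mul_eq₀ hc.ne'] at h
  rw [← h, besselK]
  have h2 : ∫ t in Ioi (0 : ℝ), (q / a * t) ^ (s - 1) *
        exp (-(a ^ 2 * (q / a * t) + q ^ 2 / (q / a * t)) / 2) =
      (q / a) ^ (s - 1) * ∫ t in Ioi (0 : ℝ), t ^ (s - 1) * exp (-(a * q) * (t + 1 / t) / 2) := by
    rw [← integral_const_mul]
    refine setIntegral_congr_fun measurableSet_Ioi fun t ht => ?_
    have ht : 0 < t := ht
    rw [mul_rpow hc.le ht.le, mul_assoc]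
    congr 3
    field_simp
  rw [h2, rpow_sub_one hc.ne']
  generalize ∫ t in Ioi (0 : ℝ), t ^ (s - 1) * exp (-(a * q) * (t + 1 / t) / 2) = I
  field_simp

theorem besselK_nonneg (p z : ℝ) : 0 ≤ besselK p z :=
  mul_nonneg (by norm_num) <| setIntegral_nonneg measurableSet_Ioi fun t ht =>
    mul_nonneg (rpow_nonneg (le_of_lt ht) _) (exp_nonneg _)

theorem fGIG_nonneg {γ δ x : ℝ} (hγ : 0 < γ) (hδ : 0 < δ) (hx : 0 < x) (p : ℝ) :
    0 ≤ fGIG γ δ p x := by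
  have := besselK_nonneg p (γ * δ)
  rw [fGIG]
  positivity

/-- Density at `y` of the normal distribution with mean `m` and variance `v`. -/
noncomputable def normalPdf (m v y : ℝ) : ℝ := exp (-(y - m) ^ 2 / (2 * v)) / √(2 * π * v)

theorem normalPdf_nonneg (m v y : ℝ) : 0 ≤ normalPdf m v y := by
  rw [normalPdf]; positivity

theorem integrable_normalPdf {v : ℝ} (hv : 0 < v) (m : ℝ) : Integrable (normalPdf m v) := by
  refine (ProbabilityTheory.integrable_gaussianPDFReal m v.toNNReal).congr ?_
  refine Filter.Eventually.of_forall fun y => ?_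
  simp only [ProbabilityTheory.gaussianPDFReal, normalPdf, coe_toNNReal v hv.le]
  ring

theorem exp_mul_normalPdf {v : ℝ} (hv : 0 < v) (m y : ℝ) :
    exp y * normalPdf m v y = exp (m + v / 2) * normalPdf (m + v) v y := by
  rw [normalPdf, normalPdf, ← mul_div_assoc, ← mul_div_assoc, ← exp_add, ← exp_add]
  congr 2
  field_simp
  ring

theorem setIntegral_Ici_normalPdf {v : ℝ} (hv : 0 < v) (m c : ℝ) :
    ∫ y in Ici c, normalPdf m v y = stdNormalCDF ((m - c) / √v) := by
  have hs : 0 < √v := sqrt_pos.2 hv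
  set g : ℝ → ℝ := (Ici c).indicator (normalPdf m v)
  have h1 : ∫ t, g (m - √v * t) = (√v)⁻¹ * ∫ y, g y := by
    rw [Measure.integral_comp_mul_left (fun t => g (m - t)), abs_of_pos (inv_pos.2 hs),
      smul_eq_mul, integral_sub_left_eq_self]
  rw [eq_inv_mul_iff_mul_eq₀ hs.ne'] at h1
  rw [← integral_indicator measurableSet_Ici, ← h1, stdNormalCDF,
    ← integral_indicator measurableSet_Iic, ← integral_const_mul]
  congr 1 with t
  have hiff : m - √v * t ∈ Ici c ↔ t ∈ Iic ((m - c) / √v) := by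
    rw [mem_Ici, mem_Iic, le_div_iff₀ hs]
    constructor <;> intro h <;> linarith
  by_cases ht : t ∈ Iic ((m - c) / √v)
  · simp only [g, indicator_of_mem ht, indicator_of_mem (hiff.2 ht)]
    rw [normalPdf, stdNormalPdf, sqrt_mul (by positivity)]
    have hexp : -(m - √v * t - m) ^ 2 / (2 * v) = -t ^ 2 / 2 := by
      rw [show -(m - √v * t - m) ^ 2 = -(√v ^ 2 * t ^ 2) by ring, sq_sqrt hv.le]
      field_simp
    rw [hexp]
    field_simp
  · simp only [g, indicator_of_notMem ht, indicator_of_notMem (mt hiff.1 ht), mul_zero]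

theorem max_exp_sub_mul_eq_indicator {K : ℝ} (hK : 0 < K) (f : ℝ → ℝ) :
    (fun y => max (exp y - K) 0 * f y) =
      (Ici (log K)).indicator fun y => exp y * f y - K * f y := by
  ext y
  by_cases hy : y ∈ Ici (log K)
  · rw [indicator_of_mem hy, max_eq_left (sub_nonneg.2 ((log_le_iff_le_exp hK).1 hy)), sub_mul]
  · rw [indicator_of_notMem hy, max_eq_right, zero_mul]
    exact sub_nonpos.2 ((lt_log_iff_exp_lt hK).1 (not_le.1 hy)).le

theorem integrable_exp_mul_normalPdf {v : ℝ} (hv : 0 < v) (m : ℝ) :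
    Integrable fun y => exp y * normalPdf m v y := by
  simp only [exp_mul_normalPdf hv]
  exact (integrable_normalPdf hv _).const_mul _

theorem integrable_call_mul_normalPdf {K v : ℝ} (hK : 0 < K) (hv : 0 < v) (m : ℝ) :
    Integrable fun y => max (exp y - K) 0 * normalPdf m v y := by
  rw [max_exp_sub_mul_eq_indicator hK]
  exact ((integrable_exp_mul_normalPdf hv m).sub
    ((integrable_normalPdf hv m).const_mul K)).indicator measurableSet_Ici

/-- The Black–Scholes formula: the expected call payoff under a lognormal distribution. -/
theorem integral_call_mul_normalPdf {K v : ℝ} (hK : 0 < K) (hv : 0 < v) (m : ℝ) :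
    ∫ y, max (exp y - K) 0 * normalPdf m v y =
      exp (m + v / 2) * stdNormalCDF ((m + v - log K) / √v) -
        K * stdNormalCDF ((m - log K) / √v) := by
  rw [max_exp_sub_mul_eq_indicator hK, integral_indicator measurableSet_Ici,
    integral_sub (integrable_exp_mul_normalPdf hv m).integrableOn
      ((integrable_normalPdf hv m).const_mul K).integrableOn,
    integral_const_mul, setIntegral_Ici_normalPdf hv]
  simp only [exp_mul_normalPdf hv]
  rw [integral_const_mul, setIntegral_Ici_normalPdf hv]

theorem normalPdf_mul_fGIG {μ β γ δ p x y : ℝ} (hx : 0 < x) :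
    normalPdf (μ + β * x) x y * fGIG γ δ p x =
      (γ / δ) ^ p / (2 * √(2 * π) * besselK p (δ * γ)) * exp (β * (y - μ)) *
        (x ^ (p - 1 / 2 - 1) *
          exp (-(√(β ^ 2 + γ ^ 2) ^ 2 * x + √(δ ^ 2 + (y - μ) ^ 2) ^ 2 / x) / 2)) := by
  have hexp : exp (-(y - (μ + β * x)) ^ 2 / (2 * x)) * exp (-(γ ^ 2 * x + δ ^ 2 / x) / 2) =
      exp (β * (y - μ)) * exp (-((β ^ 2 + γ ^ 2) * x + (δ ^ 2 + (y - μ) ^ 2) / x) / 2) := by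
    rw [← exp_add, ← exp_add]
    congr 1
    field_simp
    ring
  have hpow : x ^ (p - 1) / √x = x ^ (p - 1 / 2 - 1) := by
    rw [sqrt_eq_rpow, ← rpow_sub hx]
    congr 1
    ring
  rw [sq_sqrt (by positivity), sq_sqrt (by positivity), ← hpow, normalPdf, fGIG,
    sqrt_mul (by positivity), mul_comm γ δ]
  calc _ = (γ / δ) ^ p / (2 * √(2 * π) * besselK p (δ * γ)) * (x ^ (p - 1) / √x) *
        (exp (-(y - (μ + β * x)) ^ 2 / (2 * x)) * exp (-(γ ^ 2 * x + δ ^ 2 / x) / 2)) := by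
        ring
    _ = _ := by rw [hexp]; ring

theorem integrableOn_normalPdf_mul_fGIG {γ δ : ℝ} (hγ : 0 < γ) (hδ : 0 < δ) (μ β p y : ℝ) :
    IntegrableOn (fun x => normalPdf (μ + β * x) x y * fGIG γ δ p x) (Ioi 0) :=
  IntegrableOn.congr_fun ((integrableOn_rpow_mul_exp_neg_add_div (a := √(β ^ 2 + γ ^ 2) ^ 2)
    (b := √(δ ^ 2 + (y - μ) ^ 2) ^ 2) (by positivity) (by positivity) _).const_mul _)
    (fun _ hx => (normalPdf_mul_fGIG hx).symm) measurableSet_Ioi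

/-- The generalized hyperbolic distribution is a normal mean-variance mixture with generalized
inverse Gaussian mixing distribution. -/
theorem integral_normalPdf_mul_fGIG {γ δ : ℝ} (hγ : 0 < γ) (hδ : 0 < δ) (μ β p y : ℝ) :
    ∫ x in Ioi (0 : ℝ), normalPdf (μ + β * x) x y * fGIG γ δ p x = fGH μ β γ δ p y := by
  rw [setIntegral_congr_fun measurableSet_Ioi fun x hx => normalPdf_mul_fGIG hx,
    integral_const_mul, integral_rpow_mul_exp_neg_add_div (by positivity) (by positivity), fGH]
  have hα : 0 < √(β ^ 2 + γ ^ 2) := by positivity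
  have hQ : 0 < δ ^ 2 + (y - μ) ^ 2 := by positivity
  generalize √(β ^ 2 + γ ^ 2) = α at hα ⊢
  generalize δ ^ 2 + (y - μ) ^ 2 = Q at hQ ⊢
  have h1 : (√Q / α) ^ (p - 1 / 2) = √α / α ^ p / Q ^ ((1 - 2 * p) / 4) := by
    rw [div_rpow (sqrt_nonneg _) hα.le, rpow_sub hα, sqrt_eq_rpow, sqrt_eq_rpow, ← rpow_mul hQ.le,
      show 1 / 2 * (p - 1 / 2) = -((1 - 2 * p) / 4) by ring, rpow_neg hQ.le]
    field_simp
  have h2 : (γ / (α * δ)) ^ p = (γ / δ) ^ p / α ^ p := by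
    rw [← div_rpow (by positivity) hα.le]
    congr 1
    field_simp
  rw [h1, h2]
  ring

/-- European call price under the GH distribution as a
Black–Scholes mixture. -/
theorem gh_call_price_mixture (μ β γ δ p K : ℝ) (hγ : 0 < γ) (hδ : 0 < δ)
    (hcond : 2 * β + 1 < γ ^ 2) (hK : 0 < K) :
    let F : ℝ → ℝ := fun x => Real.exp (μ + (β + 1 / 2) * x)
    let d : ℝ → ℝ := fun x => Real.log (F x / K) / Real.sqrt x - Real.sqrt x / 2
    ∫ y, max (Real.exp y - K) 0 * fGH μ β γ δ p y =
      ∫ x in Set.Ioi (0 : ℝ),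
        (F x * stdNormalCDF (d x + Real.sqrt x) - K * stdNormalCDF (d x)) *
          fGIG γ δ p x := by
  intro F d
  have hswap := integral_integral_swap_of_nonneg (μ := volume)
    (ν := volume.restrict (Ioi (0 : ℝ)))
    (f := fun y x => max (exp y - K) 0 * (normalPdf (μ + β * x) x y * fGIG γ δ p x))
    (by
      unfold normalPdf fGIG
      exact Measurable.stronglyMeasurable (by fun_prop))
    (by
      filter_upwards [ae_restrict_mem measurableSet_Ioi] with x hx y
      exact mul_nonneg (le_max_right _ _)
        (mul_nonneg (normalPdf_nonneg _ _ _) (fGIG_nonneg hγ hδ hx p)))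
    (fun y => (integrableOn_normalPdf_mul_fGIG hγ hδ μ β p y).const_mul _)
    (by
      filter_upwards [ae_restrict_mem measurableSet_Ioi] with x hx
      simp only [← mul_assoc]
      exact (integrable_call_mul_normalPdf hK hx _).mul_const _)
  simp only [integral_const_mul, integral_normalPdf_mul_fGIG hγ hδ] at hswap
  rw [hswap]
  refine setIntegral_congr_fun measurableSet_Ioi fun x hx => ?_
  have hx : 0 < x := hx
  have hs : 0 < √x := sqrt_pos.2 hx
  have hsq : √x * √x = x := mul_self_sqrt hx.le
  have hF : log (F x / K) = μ + β * x - log K + √x * √x / 2 := by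
    rw [log_div (exp_pos _).ne' hK.ne', log_exp, hsq]
    ring
  have hd : d x = (μ + β * x - log K) / √x := by
    simp only [d, hF]
    field_simp
    ring
  have hd' : d x + √x = (μ + β * x + x - log K) / √x := by
    rw [hd]
    field_simp
    rw [sq_sqrt hx.le]
    ring
  simp only [← mul_assoc, integral_mul_const]
  rw [integral_call_mul_normalPdf hK hx, hd', hd,
    show μ + β * x + x / 2 = μ + (β + 1 / 2) * x by ring]
end
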